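/- Let n ≥ 4 be even. There exists a constant κ_n > 0 such that for all x, y ∈ ℝⁿ₊ with x ≠ y, ∫_{ℝⁿ₊} (1/|x−z|^{n−2} − 1/|x̄−z|^{n−2}) (1/|z−y|² − 1/|z̄−y|²) dz = κ_n (ln(1/|x−y|) − ln(1/|x̄−y|)). In particular, the Green's function G⁺(x,y) of (−Δ)^{n/2} on ℝⁿ₊ with Navier boundary conditions equals ∫_{ℝⁿ₊} G(x,z,2) G(z,y,n−2) dz, where G(x,y,i) := c_i (1/|x−y|^{n−i} − 1/|x̄−y|^{n−i}) are the Green's functions of the intermediate orders, with suitable positive constants. -/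

import Mathlib

open MeasureTheory Real Set Metric

noncomputable section

abbrev E (n : ℕ) := EuclideanSpace ℝ (Fin n)

/-- The last coordinate `xₙ` of a point `x ∈ ℝⁿ` (junk value `0` when `n = 0`). -/
def lastCoord (n : ℕ) (x : E n) : ℝ :=
  if h : 0 < n then x ⟨n - 1, Nat.sub_lt h Nat.one_pos⟩ else 0

/-- The upper half space `ℝⁿ₊ = {x : xₙ > 0}`. -/
def halfSpace (n : ℕ) : Set (E n) := {x | 0 < lastCoord n x}

/-- The last standard basis vector `eₙ`. -/
def lastBasis (n : ℕ) : E n :=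
  if h : 0 < n then EuclideanSpace.single ⟨n - 1, Nat.sub_lt h Nat.one_pos⟩ (1 : ℝ) else 0

/-- The reflection `x̄ = (x₁, …, x_{n−1}, −xₙ)` of `x` across `∂ℝⁿ₊`. -/
def reflect (n : ℕ) (x : E n) : E n := x - (2 * lastCoord n x) • lastBasis n

/-- The kernel `G⁺(x,y) = C_n (ln(1/|x−y|) − ln(1/|x̄−y|))`, the Green function of
`(−Δ)^{n/2}` on the half space with Navier boundary conditions. -/
def Gplus (n : ℕ) (Cn : ℝ) (x y : E n) : ℝ :=
  Cn * (Real.log (1 / ‖x - y‖) - Real.log (1 / ‖reflect n x - y‖))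

/-- The Laplacian `Δu = ∑ᵢ ∂²u/∂xᵢ²`. -/
def lap (n : ℕ) (u : E n → ℝ) (x : E n) : ℝ :=
  ∑ i, fderiv ℝ (fun y => fderiv ℝ u y (EuclideanSpace.single i 1)) x
    (EuclideanSpace.single i 1)

/-- The iterate `(−Δ)^k u` of the negative Laplacian. -/
def negLapIter (n k : ℕ) (u : E n → ℝ) : E n → ℝ :=
  (fun v x => - lap n v x)^[k] u

open Filter Topology

lemma integral_pow_mul_exp_neg_mul_Ioi (k : ℕ) {p : ℝ} (hp : 0 < p) :
    ∫ s in Ioi (0 : ℝ), s ^ k * rexp (-(s * p)) = k.factorial / p ^ (k + 1) := by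
  have h := Real.integral_rpow_mul_exp_neg_mul_Ioi (a := (k : ℝ) + 1) (r := p) (by positivity) hp
  rw [Real.Gamma_nat_eq_factorial] at h
  have e : ((k : ℝ) + 1) = ((k + 1 : ℕ) : ℝ) := by push_cast; ring
  simp only [add_sub_cancel_right, rpow_natCast] at h
  rw [e, rpow_natCast] at h
  simp only [mul_comm p] at h
  rw [h, one_div, inv_pow]
  field_simp

lemma integrableOn_pow_mul_exp_neg_mul_Ioi (k : ℕ) {p : ℝ} (hp : 0 < p) :
    IntegrableOn (fun s : ℝ => s ^ k * rexp (-(s * p))) (Ioi 0) := by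
  apply Integrable.of_integral_ne_zero
  rw [integral_pow_mul_exp_neg_mul_Ioi k hp]
  positivity

/-- Difference form of the Laplace representation of a negative power. -/
lemma lintegral_pow_mul_exp_sub_exp (k : ℕ) {p q : ℝ} (hp : 0 < p) (hpq : p ≤ q) :
    ∫⁻ s in Ioi (0 : ℝ), ENNReal.ofReal (s ^ k * (rexp (-(s * p)) - rexp (-(s * q)))) =
      ENNReal.ofReal (k.factorial * (1 / p ^ (k + 1) - 1 / q ^ (k + 1))) := by
  have hq := hp.trans_le hpq
  have i1 := integrableOn_pow_mul_exp_neg_mul_Ioi k hp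
  have i2 := integrableOn_pow_mul_exp_neg_mul_Ioi k hq
  have i : IntegrableOn (fun s : ℝ => s ^ k * (rexp (-(s * p)) - rexp (-(s * q)))) (Ioi 0) := by
    simp only [mul_sub]
    exact i1.sub i2
  rw [← ofReal_integral_eq_lintegral_ofReal i]
  · simp only [mul_sub]
    rw [integral_sub i1 i2, integral_pow_mul_exp_neg_mul_Ioi k hp,
      integral_pow_mul_exp_neg_mul_Ioi k hq]
    congr 1; ring
  · refine (ae_restrict_iff' measurableSet_Ioi).2 (ae_of_all _ fun s (hs : 0 < s) => ?_)
    have : rexp (-(s * q)) ≤ rexp (-(s * p)) := by gcongr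
    exact mul_nonneg (by positivity) (sub_nonneg.2 this)

/-- Rescaled representation of the difference of reciprocals. -/
lemma lintegral_const_mul_exp_sub_exp {s p q : ℝ} (hs : 0 < s) (hp : 0 < p) (hpq : p ≤ q) :
    ∫⁻ t in Ioi (0 : ℝ), ENNReal.ofReal (s * (rexp (-(s * t * p)) - rexp (-(s * t * q)))) =
      ENNReal.ofReal (1 / p - 1 / q) := by
  have h := lintegral_pow_mul_exp_sub_exp 0 (mul_pos hs hp) (mul_le_mul_of_nonneg_left hpq hs.le)
  have e : ∀ t p : ℝ, s * t * p = t * (s * p) := fun t p => by ring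
  simp only [e, ENNReal.ofReal_mul hs.le]
  rw [lintegral_const_mul _ (by fun_prop)]
  simp only [pow_zero, one_mul, Nat.factorial_zero, Nat.cast_one, zero_add, pow_one] at h
  rw [h, ← ENNReal.ofReal_mul hs.le]
  congr 1
  have := hp.trans_le hpq
  field_simp

/-- The Frullani integral of the exponential. -/
lemma lintegral_frullani_exp {a b : ℝ} (ha : 0 < a) (hab : a ≤ b) :
    ∫⁻ s in Ioi (0 : ℝ), ENNReal.ofReal (s⁻¹ * (rexp (-(s * a)) - rexp (-(s * b)))) =
      ENNReal.ofReal (Real.log (b / a)) := by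
  have hb := ha.trans_le hab
  have inner : ∀ s ∈ Ioi (0 : ℝ),
      ENNReal.ofReal (s⁻¹ * (rexp (-(s * a)) - rexp (-(s * b)))) =
        ∫⁻ u in Ioc a b, ENNReal.ofReal (rexp (-(s * u))) := by
    intro s (hs : 0 < s)
    have hc : Continuous fun u : ℝ => rexp (-(s * u)) := by fun_prop
    rw [← ofReal_integral_eq_lintegral_ofReal
      (hc.integrableOn_Icc.mono_set Ioc_subset_Icc_self) (ae_of_all _ fun u => (exp_pos _).le),
      ← intervalIntegral.integral_of_le hab]
    have hd : ∀ u ∈ uIcc a b, HasDerivAt (fun u => -(s⁻¹ * rexp (-(s * u)))) (rexp (-(s * u))) u := by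
      intro u _
      have h1 : HasDerivAt (fun u : ℝ => -(s * u)) (-(s * 1)) u :=
        ((hasDerivAt_id u).const_mul s).neg
      refine (h1.exp.const_mul s⁻¹).neg.congr_deriv ?_
      have := hs.ne'
      field_simp
    rw [intervalIntegral.integral_eq_sub_of_hasDerivAt hd (hc.intervalIntegrable _ _)]
    congr 1; ring
  rw [setLIntegral_congr_fun measurableSet_Ioi inner, lintegral_lintegral_swap (by fun_prop)]
  have outer : ∀ u ∈ Ioc a b,
      ∫⁻ s in Ioi (0 : ℝ), ENNReal.ofReal (rexp (-(s * u))) = ENNReal.ofReal u⁻¹ := by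
    intro u hu
    have hu0 : 0 < u := ha.trans hu.1
    have i := integrableOn_pow_mul_exp_neg_mul_Ioi 0 hu0
    have v := integral_pow_mul_exp_neg_mul_Ioi 0 hu0
    simp only [pow_zero, one_mul] at i v
    rw [← ofReal_integral_eq_lintegral_ofReal i (ae_of_all _ fun u => (exp_pos _).le), v]
    simp
  rw [setLIntegral_congr_fun measurableSet_Ioc outer, ← ofReal_integral_eq_lintegral_ofReal,
    ← intervalIntegral.integral_of_le hab, integral_inv_of_pos ha hb]
  · refine IntegrableOn.mono_set (ContinuousOn.integrableOn_Icc ?_) Ioc_subset_Icc_self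
    exact continuousOn_inv₀.mono fun u hu => (ha.trans_le hu.1).ne'
  · exact (ae_restrict_iff' measurableSet_Ioc).2
      (ae_of_all _ fun u hu => inv_nonneg.2 (ha.trans hu.1).le)

lemma lintegral_inv_one_add_pow (m : ℕ) :
    ∫⁻ t in Ioi (0 : ℝ), ENNReal.ofReal (((1 + t) ^ (m + 2))⁻¹) =
      ENNReal.ofReal ((m + 1 : ℝ)⁻¹) := by
  have hd : ∀ t ∈ Ici (0 : ℝ), HasDerivAt (fun t : ℝ => -((m + 1 : ℝ)⁻¹ * ((1 + t) ^ (m + 1))⁻¹))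
      (((1 + t) ^ (m + 2))⁻¹) t := by
    intro t (ht : 0 ≤ t)
    have h1 : HasDerivAt (fun t : ℝ => 1 + t) 1 t := (hasDerivAt_id t).const_add 1
    have h0 : (1 + t) ≠ 0 := by positivity
    refine (((h1.pow (m + 1)).inv (pow_ne_zero _ h0)).const_mul ((m + 1 : ℝ)⁻¹)).neg.congr_deriv ?_
    have hm : (m + 1 : ℝ) ≠ 0 := by positivity
    simp only [Pi.pow_apply]
    push_cast
    field_simp
    ring
  have hl : Tendsto (fun t : ℝ => -((m + 1 : ℝ)⁻¹ * ((1 + t) ^ (m + 1))⁻¹)) atTop (𝓝 0) := by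
    have : Tendsto (fun t : ℝ => ((1 + t) ^ (m + 1))⁻¹) atTop (𝓝 0) :=
      tendsto_inv_atTop_zero.comp
        ((tendsto_pow_atTop (by omega)).comp (tendsto_atTop_add_const_left _ 1 tendsto_id))
    simpa using (this.const_mul ((m + 1 : ℝ)⁻¹)).neg
  have hp : ∀ t ∈ Ioi (0 : ℝ), 0 ≤ ((1 + t) ^ (m + 2))⁻¹ := fun t (ht : 0 < t) => by positivity
  rw [← ofReal_integral_eq_lintegral_ofReal (integrableOn_Ioi_deriv_of_nonneg' hd hp hl)
    ((ae_restrict_iff' measurableSet_Ioi).2 (ae_of_all _ hp)),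
    integral_Ioi_of_hasDerivAt_of_nonneg' hd hp hl]
  simp

section Gaussian

variable {V : Type*} [NormedAddCommGroup V] [InnerProductSpace ℝ V]

lemma mul_norm_sub_sq_add_mul_norm_sub_sq {s t : ℝ} (h : 0 < s + t) (x y z : V) :
    s * ‖x - z‖ ^ 2 + t * ‖z - y‖ ^ 2 =
      (s + t) * ‖z - (s + t)⁻¹ • (s • x + t • y)‖ ^ 2 + s * t / (s + t) * ‖x - y‖ ^ 2 := by
  simp only [@norm_sub_sq_real V, norm_smul, mul_pow, inner_smul_right, inner_add_right,
    @norm_add_sq_real V, inner_smul_left, norm_eq_abs, sq_abs, real_inner_comm x z]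
  simp
  field_simp
  ring

variable [FiniteDimensional ℝ V] [MeasurableSpace V] [BorelSpace V]

lemma integral_exp_mul_exp_norm_sub_sq {s t : ℝ} (h : 0 < s + t) (x y : V) :
    ∫ z : V, rexp (-(s * ‖x - z‖ ^ 2)) * rexp (-(t * ‖z - y‖ ^ 2)) =
      (π / (s + t)) ^ (Module.finrank ℝ V / 2 : ℝ) * rexp (-(s * t / (s + t) * ‖x - y‖ ^ 2)) := by
  have e : ∀ z : V, rexp (-(s * ‖x - z‖ ^ 2)) * rexp (-(t * ‖z - y‖ ^ 2)) =
      rexp (-(s + t) * ‖z - (s + t)⁻¹ • (s • x + t • y)‖ ^ 2) *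
        rexp (-(s * t / (s + t) * ‖x - y‖ ^ 2)) := by
    intro z
    rw [← Real.exp_add, ← Real.exp_add, ← neg_add, mul_norm_sub_sq_add_mul_norm_sub_sq h]
    congr 1; ring
  simp only [e]
  rw [integral_mul_const, integral_sub_right_eq_self (fun z : V => rexp (-(s + t) * ‖z‖ ^ 2)),
    GaussianFourier.integral_rexp_neg_mul_sq_norm h]

lemma integrable_exp_mul_exp_norm_sub_sq {s t : ℝ} (h : 0 < s + t) (x y : V) :
    Integrable fun z : V => rexp (-(s * ‖x - z‖ ^ 2)) * rexp (-(t * ‖z - y‖ ^ 2)) := by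
  apply Integrable.of_integral_ne_zero
  rw [integral_exp_mul_exp_norm_sub_sq h]
  have := pi_pos
  positivity

end Gaussian

section Reflection

variable {n : ℕ}

lemma lastCoord_eq_inner (hn : 0 < n) (x : E n) : lastCoord n x = inner ℝ (lastBasis n) x := by
  simp [lastCoord, lastBasis, hn, EuclideanSpace.inner_single_left]

lemma norm_lastBasis (hn : 0 < n) : ‖lastBasis n‖ = 1 := by
  simp [lastBasis, hn]

lemma continuous_lastCoord (hn : 0 < n) : Continuous (lastCoord n) := by
  rw [show lastCoord n = fun x => inner ℝ (lastBasis n) x from funext (lastCoord_eq_inner hn)]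
  fun_prop

lemma measurableSet_halfSpace (hn : 0 < n) : MeasurableSet (halfSpace n) :=
  (isOpen_lt continuous_const (continuous_lastCoord hn)).measurableSet

/-- Reflection across `∂ℝⁿ₊` as a linear isometry. -/
def reflectIsometry (n : ℕ) : E n ≃ₗᵢ[ℝ] E n :=
  (Submodule.span ℝ {lastBasis n})ᗮ.reflection

lemma reflectIsometry_apply (hn : 0 < n) (x : E n) : reflectIsometry n x = reflect n x := by
  rw [reflectIsometry, Submodule.reflection_orthogonal_apply, Submodule.reflection_singleton_apply,
    reflect, lastCoord_eq_inner hn, norm_lastBasis hn]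
  simp [two_smul, two_mul, add_smul]

lemma reflect_reflect (hn : 0 < n) (x : E n) : reflect n (reflect n x) = x := by
  simp only [← reflectIsometry_apply hn]
  exact Submodule.reflection_reflection _ x

lemma norm_reflect_sub (hn : 0 < n) (x y : E n) : ‖reflect n x - y‖ = ‖x - reflect n y‖ := by
  conv_lhs => rw [← reflect_reflect hn y]
  simp only [← reflectIsometry_apply hn, ← map_sub, LinearIsometryEquiv.norm_map]

lemma lastCoord_reflect (hn : 0 < n) (x : E n) : lastCoord n (reflect n x) = -lastCoord n x := by
  rw [lastCoord_eq_inner hn, reflect, inner_sub_right, inner_smul_right,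
    real_inner_self_eq_norm_sq, norm_lastBasis hn, ← lastCoord_eq_inner hn]
  ring

lemma norm_reflect_sub_sq (hn : 0 < n) (x y : E n) :
    ‖reflect n x - y‖ ^ 2 = ‖x - y‖ ^ 2 + 4 * lastCoord n x * lastCoord n y := by
  have : reflect n x - y = (x - y) - (2 * lastCoord n x) • lastBasis n := by
    rw [reflect]; abel
  rw [this, norm_sub_sq_real, inner_smul_right, norm_smul, norm_lastBasis hn, real_inner_comm,
    inner_sub_right, ← lastCoord_eq_inner hn, ← lastCoord_eq_inner hn, mul_one, norm_eq_abs, sq_abs]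
  ring

/-- Folding an integral over `ℝⁿ` onto the half space, for integrands vanishing on the boundary. -/
lemma setIntegral_halfSpace_add_reflect (hn : 0 < n) {f : E n → ℝ} (hf : Integrable f)
    (h0 : ∀ z, lastCoord n z = 0 → f z = 0) :
    ∫ z in halfSpace n, (f z + f (reflect n z)) = ∫ z, f z := by
  have mp : MeasurePreserving (reflect n) := by
    have := (reflectIsometry n).measurePreserving
    rwa [show ⇑(reflectIsometry n) = reflect n from funext (reflectIsometry_apply hn)] at this
  have me : MeasurableEmbedding (reflect n) := by
    have := (reflectIsometry n).toHomeomorph.measurableEmbedding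
    rwa [show ⇑(reflectIsometry n).toHomeomorph = reflect n from
      funext (reflectIsometry_apply hn)] at this
  have hH := measurableSet_halfSpace hn
  have hpre : reflect n ⁻¹' {z | lastCoord n z < 0} = halfSpace n := by
    ext z; simp [halfSpace, lastCoord_reflect hn]
  have hfr : Integrable fun z => f (reflect n z) := (mp.integrable_comp_emb me).2 hf
  rw [integral_add hf.integrableOn hfr.integrableOn, ← integral_add_compl hH hf]
  congr 1
  rw [← hpre, mp.setIntegral_preimage_emb me, hpre]
  symm
  apply setIntegral_eq_of_subset_of_forall_sdiff_eq_zero hH.compl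
  · intro z hz; simp only [halfSpace, mem_compl_iff, mem_ofPred_eq] at *; linarith
  · rintro z ⟨hz, hz'⟩
    simp only [halfSpace, mem_compl_iff, mem_ofPred_eq, not_lt] at *
    exact h0 z (le_antisymm hz hz')

/-- Semigroup-type identity for the odd Gaussian kernels of the half space. -/
lemma setIntegral_halfSpace_gaussian (hn : 0 < n) {s t : ℝ} (h : 0 < s + t) (x y : E n) :
    IntegrableOn (fun z => (rexp (-(s * ‖x - z‖ ^ 2)) - rexp (-(s * ‖reflect n x - z‖ ^ 2))) *
        (rexp (-(t * ‖z - y‖ ^ 2)) - rexp (-(t * ‖reflect n z - y‖ ^ 2)))) (halfSpace n) ∧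
    ∫ z in halfSpace n, (rexp (-(s * ‖x - z‖ ^ 2)) - rexp (-(s * ‖reflect n x - z‖ ^ 2))) *
        (rexp (-(t * ‖z - y‖ ^ 2)) - rexp (-(t * ‖reflect n z - y‖ ^ 2))) =
      (π / (s + t)) ^ (n / 2 : ℝ) * (rexp (-(s * t / (s + t) * ‖x - y‖ ^ 2)) -
        rexp (-(s * t / (s + t) * ‖reflect n x - y‖ ^ 2))) := by
  have i := fun x y : E n => integrable_exp_mul_exp_norm_sub_sq h x y
  have v := fun x y : E n => integral_exp_mul_exp_norm_sub_sq h x y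
  simp only [finrank_euclideanSpace_fin] at v
  constructor
  · simp only [mul_sub, sub_mul, norm_reflect_sub hn _ y]
    exact (((i _ _).sub (i _ _)).sub ((i _ _).sub (i _ _))).integrableOn
  · have e := setIntegral_halfSpace_add_reflect hn
      (f := fun z => rexp (-(s * ‖x - z‖ ^ 2)) * rexp (-(t * ‖z - y‖ ^ 2)) -
        rexp (-(s * ‖x - z‖ ^ 2)) * rexp (-(t * ‖z - reflect n y‖ ^ 2)))
      ((i _ _).sub (i _ _)) (fun z hz => by simp [← norm_reflect_sub hn, norm_reflect_sub_sq hn, hz])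
    rw [integral_sub (i _ _) (i _ _), v, v] at e
    rw [norm_reflect_sub hn x y, mul_sub, ← e]
    refine integral_congr_ae (ae_of_all _ fun z => ?_)
    simp only [norm_reflect_sub hn, reflect_reflect hn]
    ring

end Reflection

section Composition

variable {n : ℕ}

lemma lastCoord_mul_nonneg {x y : E n} (hx : x ∈ halfSpace n) (hy : y ∈ halfSpace n) :
    0 ≤ 4 * lastCoord n x * lastCoord n y :=
  mul_nonneg (mul_nonneg (by norm_num) (le_of_lt hx)) (le_of_lt hy)

lemma norm_sub_sq_le_norm_reflect_sub_sq (hn : 0 < n) {x y : E n} (hx : x ∈ halfSpace n)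
    (hy : y ∈ halfSpace n) : ‖x - y‖ ^ 2 ≤ ‖reflect n x - y‖ ^ 2 := by
  rw [norm_reflect_sub_sq hn]
  exact le_add_of_nonneg_right (lastCoord_mul_nonneg hx hy)

lemma exp_neg_mul_sub_exp_neg_mul_nonneg {s p q : ℝ} (hs : 0 ≤ s) (hpq : p ≤ q) :
    0 ≤ rexp (-(s * p)) - rexp (-(s * q)) := by
  have : rexp (-(s * q)) ≤ rexp (-(s * p)) := by gcongr
  exact sub_nonneg.2 this

/-- Representation of the product of the two Green kernels as a superposition of Gaussians. -/
lemma lintegral_lintegral_gaussian_product (k : ℕ) {p p' q q' : ℝ} (hp : 0 < p) (hpp : p ≤ p')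
    (hq : 0 < q) (hqq : q ≤ q') :
    ∫⁻ s in Ioi (0 : ℝ), ∫⁻ t in Ioi (0 : ℝ),
      ENNReal.ofReal ((s ^ k * (rexp (-(s * p)) - rexp (-(s * p')))) *
        (s * (rexp (-(s * t * q)) - rexp (-(s * t * q'))))) =
      ENNReal.ofReal (k.factorial * ((1 / p ^ (k + 1) - 1 / p' ^ (k + 1)) * (1 / q - 1 / q'))) := by
  have inner : ∀ s ∈ Ioi (0 : ℝ), ∫⁻ t in Ioi (0 : ℝ),
      ENNReal.ofReal ((s ^ k * (rexp (-(s * p)) - rexp (-(s * p')))) *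
        (s * (rexp (-(s * t * q)) - rexp (-(s * t * q'))))) =
      ENNReal.ofReal (s ^ k * (rexp (-(s * p)) - rexp (-(s * p')))) *
        ENNReal.ofReal (1 / q - 1 / q') := by
    intro s (hs : 0 < s)
    have h0 : 0 ≤ s ^ k * (rexp (-(s * p)) - rexp (-(s * p'))) :=
      mul_nonneg (by positivity) (exp_neg_mul_sub_exp_neg_mul_nonneg hs.le hpp)
    simp only [ENNReal.ofReal_mul h0]
    rw [lintegral_const_mul _ (by fun_prop), lintegral_const_mul_exp_sub_exp hs hq hqq]
  have h1 : 0 ≤ (k.factorial : ℝ) * (1 / p ^ (k + 1) - 1 / p' ^ (k + 1)) :=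
    mul_nonneg (by positivity) (sub_nonneg.2 (by gcongr))
  rw [setLIntegral_congr_fun measurableSet_Ioi inner, lintegral_mul_const _ (by fun_prop),
    lintegral_pow_mul_exp_sub_exp k hp hpp, ← ENNReal.ofReal_mul h1, mul_assoc]

lemma setLIntegral_halfSpace_gaussian_product {k : ℕ} (hn : n = 2 * k + 4) {s t : ℝ} (hs : 0 < s)
    (ht : 0 < t) {x y : E n} (hx : x ∈ halfSpace n) (hy : y ∈ halfSpace n) :
    ∫⁻ z in halfSpace n, ENNReal.ofReal
      ((s ^ k * (rexp (-(s * ‖x - z‖ ^ 2)) - rexp (-(s * ‖reflect n x - z‖ ^ 2)))) *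
        (s * (rexp (-(s * t * ‖z - y‖ ^ 2)) - rexp (-(s * t * ‖reflect n z - y‖ ^ 2))))) =
      ENNReal.ofReal (π ^ (k + 2) * ((1 + t) ^ (k + 2))⁻¹ *
        (s⁻¹ * (rexp (-(s * (t / (1 + t) * ‖x - y‖ ^ 2))) -
          rexp (-(s * (t / (1 + t) * ‖reflect n x - y‖ ^ 2)))))) := by
  have hn0 : 0 < n := by omega
  have hst : 0 < s * t := by positivity
  obtain ⟨hi, hv⟩ := setIntegral_halfSpace_gaussian hn0 (add_pos hs hst) x y
  have e : ∀ A B : ℝ, (s ^ k * A) * (s * B) = s ^ (k + 1) * (A * B) := fun A B => by ring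
  simp only [e]
  rw [← ofReal_integral_eq_lintegral_ofReal (hi.const_mul _), integral_const_mul, hv]
  · have hc : s * (s * t) / (s + s * t) = s * (t / (1 + t)) := by field_simp
    have hd : (n / 2 : ℝ) = ((k + 2 : ℕ) : ℝ) := by rw [hn]; push_cast; ring
    rw [hc, hd, rpow_natCast, div_pow, show s + s * t = s * (1 + t) by ring, mul_pow]
    simp only [mul_assoc]
    congr 1
    field_simp
    ring
  · refine (ae_restrict_iff' (measurableSet_halfSpace hn0)).2 (ae_of_all _ fun z hz => ?_)
    exact mul_nonneg (by positivity) (mul_nonneg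
      (exp_neg_mul_sub_exp_neg_mul_nonneg hs.le (norm_sub_sq_le_norm_reflect_sub_sq hn0 hx hz))
      (exp_neg_mul_sub_exp_neg_mul_nonneg hst.le (norm_sub_sq_le_norm_reflect_sub_sq hn0 hz hy)))

lemma setLIntegral_halfSpace_green_product {k : ℕ} (hn : n = 2 * k + 4) {x y : E n}
    (hx : x ∈ halfSpace n) (hy : y ∈ halfSpace n) (hxy : x ≠ y) :
    ∫⁻ z in halfSpace n, ENNReal.ofReal (k.factorial *
      ((1 / (‖x - z‖ ^ 2) ^ (k + 1) - 1 / (‖reflect n x - z‖ ^ 2) ^ (k + 1)) *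
        (1 / ‖z - y‖ ^ 2 - 1 / ‖reflect n z - y‖ ^ 2))) =
      ENNReal.ofReal (π ^ (k + 2) * (k + 1 : ℝ)⁻¹ *
        Real.log (‖reflect n x - y‖ ^ 2 / ‖x - y‖ ^ 2)) := by
  have hn0 : 0 < n := by omega
  have : Nontrivial (E n) := ⟨x, y, hxy⟩
  have hH := measurableSet_halfSpace hn0
  have hα : 0 < ‖x - y‖ ^ 2 := by have := norm_pos_iff.2 (sub_ne_zero.2 hxy); positivity
  have hαβ := norm_sub_sq_le_norm_reflect_sub_sq hn0 hx hy
  have superposition : ∀ᵐ z ∂(volume.restrict (halfSpace n)), ENNReal.ofReal (k.factorial *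
      ((1 / (‖x - z‖ ^ 2) ^ (k + 1) - 1 / (‖reflect n x - z‖ ^ 2) ^ (k + 1)) *
        (1 / ‖z - y‖ ^ 2 - 1 / ‖reflect n z - y‖ ^ 2))) =
      ∫⁻ s in Ioi (0 : ℝ), ∫⁻ t in Ioi (0 : ℝ), ENNReal.ofReal
        ((s ^ k * (rexp (-(s * ‖x - z‖ ^ 2)) - rexp (-(s * ‖reflect n x - z‖ ^ 2)))) *
        (s * (rexp (-(s * t * ‖z - y‖ ^ 2)) - rexp (-(s * t * ‖reflect n z - y‖ ^ 2))))) := by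
    rw [ae_restrict_iff' hH]
    filter_upwards [Measure.ae_ne volume x, Measure.ae_ne volume y] with z hzx hzy hz
    have h1 := norm_pos_iff.2 (sub_ne_zero.2 hzx.symm)
    have h2 := norm_pos_iff.2 (sub_ne_zero.2 hzy)
    exact (lintegral_lintegral_gaussian_product k (by positivity)
      (norm_sub_sq_le_norm_reflect_sub_sq hn0 hx hz) (by positivity)
      (norm_sub_sq_le_norm_reflect_sub_sq hn0 hz hy)).symm
  rw [lintegral_congr_ae superposition, lintegral_lintegral_swap]
  swap
  · refine Measurable.aemeasurable (Measurable.lintegral_prod_right' (f := fun w : (E n × ℝ) × ℝ =>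
      ENNReal.ofReal ((w.1.2 ^ k * (rexp (-(w.1.2 * ‖x - w.1.1‖ ^ 2)) -
        rexp (-(w.1.2 * ‖reflect n x - w.1.1‖ ^ 2)))) *
        (w.1.2 * (rexp (-(w.1.2 * w.2 * ‖w.1.1 - y‖ ^ 2)) -
          rexp (-(w.1.2 * w.2 * ‖reflect n w.1.1 - y‖ ^ 2)))))) ?_)
    simp only [norm_reflect_sub hn0 _ y]
    fun_prop
  have gaussian : ∀ s ∈ Ioi (0 : ℝ), ∫⁻ z in halfSpace n, ∫⁻ t in Ioi (0 : ℝ), ENNReal.ofReal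
        ((s ^ k * (rexp (-(s * ‖x - z‖ ^ 2)) - rexp (-(s * ‖reflect n x - z‖ ^ 2)))) *
        (s * (rexp (-(s * t * ‖z - y‖ ^ 2)) - rexp (-(s * t * ‖reflect n z - y‖ ^ 2))))) =
      ∫⁻ t in Ioi (0 : ℝ), ENNReal.ofReal (π ^ (k + 2) * ((1 + t) ^ (k + 2))⁻¹ *
        (s⁻¹ * (rexp (-(s * (t / (1 + t) * ‖x - y‖ ^ 2))) -
          rexp (-(s * (t / (1 + t) * ‖reflect n x - y‖ ^ 2)))))) := by
    intro s hs
    rw [lintegral_lintegral_swap]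
    · exact setLIntegral_congr_fun measurableSet_Ioi fun t ht =>
        setLIntegral_halfSpace_gaussian_product hn hs ht hx hy
    · simp only [norm_reflect_sub hn0 _ y]
      fun_prop
  rw [setLIntegral_congr_fun measurableSet_Ioi gaussian, lintegral_lintegral_swap (by fun_prop)]
  have frullani : ∀ t ∈ Ioi (0 : ℝ), ∫⁻ s in Ioi (0 : ℝ),
      ENNReal.ofReal (π ^ (k + 2) * ((1 + t) ^ (k + 2))⁻¹ *
        (s⁻¹ * (rexp (-(s * (t / (1 + t) * ‖x - y‖ ^ 2))) -
          rexp (-(s * (t / (1 + t) * ‖reflect n x - y‖ ^ 2)))))) =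
      ENNReal.ofReal (π ^ (k + 2)) * ENNReal.ofReal ((1 + t) ^ (k + 2))⁻¹ *
        ENNReal.ofReal (Real.log (‖reflect n x - y‖ ^ 2 / ‖x - y‖ ^ 2)) := by
    intro t (ht : 0 < t)
    have hc : 0 < t / (1 + t) := by positivity
    have h0 : 0 ≤ π ^ (k + 2) * ((1 + t) ^ (k + 2))⁻¹ := by have := pi_pos; positivity
    simp only [ENNReal.ofReal_mul h0]
    rw [lintegral_const_mul _ (by fun_prop), lintegral_frullani_exp (mul_pos hc hα)
      (mul_le_mul_of_nonneg_left hαβ hc.le), mul_div_mul_left _ _ hc.ne',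
      ENNReal.ofReal_mul (pow_nonneg pi_pos.le _)]
  have h0 : 0 ≤ π ^ (k + 2) := pow_nonneg pi_pos.le _
  rw [setLIntegral_congr_fun measurableSet_Ioi frullani, lintegral_mul_const _ (by fun_prop),
    lintegral_const_mul _ (by fun_prop), lintegral_inv_one_add_pow, ← ENNReal.ofReal_mul h0,
    ← ENNReal.ofReal_mul (by positivity)]

end Composition

/-- **Composition of Green functions on the half space** (Lemma 3.1 of the paper).
For `n ≥ 4` even there is a constant `κ_n > 0` such that for all `x ≠ y` in `ℝⁿ₊`,
`∫_{ℝⁿ₊} (1/|x−z|^{n−2} − 1/|x̄−z|^{n−2})(1/|z−y|² − 1/|z̄−y|²) dz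
  = κ_n (ln(1/|x−y|) − ln(1/|x̄−y|))`;
i.e. (up to positive constants) `G⁺(x,y) = ∫_{ℝⁿ₊} G(x,z,2) G(z,y,n−2) dz`. -/
theorem green_composition (n : ℕ) (hn : 4 ≤ n) (hev : Even n) :
    ∃ κ : ℝ, 0 < κ ∧ ∀ x ∈ halfSpace n, ∀ y ∈ halfSpace n, x ≠ y →
      (∫ z in halfSpace n,
          (1 / ‖x - z‖ ^ (n - 2) - 1 / ‖reflect n x - z‖ ^ (n - 2)) *
          (1 / ‖z - y‖ ^ 2 - 1 / ‖reflect n z - y‖ ^ 2)) =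
        κ * (Real.log (1 / ‖x - y‖) - Real.log (1 / ‖reflect n x - y‖)) := by
  obtain ⟨m, hm⟩ := hev
  obtain ⟨k, rfl⟩ : ∃ k, n = 2 * k + 4 := ⟨m - 2, by omega⟩
  set n := 2 * k + 4 with hnk
  have hn0 : 0 < n := by omega
  have hH := measurableSet_halfSpace hn0
  have hf : (0 : ℝ) < k.factorial := by positivity
  refine ⟨2 * (π ^ (k + 2) * (k + 1 : ℝ)⁻¹) / k.factorial, by have := pi_pos; positivity, ?_⟩
  intro x hx y hy hxy
  have hpow : ∀ a : ℝ, a ^ (n - 2) = (a ^ 2) ^ (k + 1) := fun a => by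
    rw [← pow_mul]; congr 1
  simp only [hpow]
  have hα : 0 < ‖x - y‖ := norm_pos_iff.2 (sub_ne_zero.2 hxy)
  have hαβ := norm_sub_sq_le_norm_reflect_sub_sq hn0 hx hy
  have hβ : 0 < ‖reflect n x - y‖ := by
    refine (norm_nonneg _).lt_of_ne fun h => ?_
    rw [← h] at hαβ
    nlinarith
  have hlog : 0 ≤ Real.log (‖reflect n x - y‖ ^ 2 / ‖x - y‖ ^ 2) :=
    Real.log_nonneg ((one_le_div (by positivity)).2 hαβ)
  have key := setLIntegral_halfSpace_green_product hnk hx hy hxy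
  have hint := integral_eq_lintegral_of_nonneg_ae (μ := volume.restrict (halfSpace n))
    (f := fun z => k.factorial *
      ((1 / (‖x - z‖ ^ 2) ^ (k + 1) - 1 / (‖reflect n x - z‖ ^ 2) ^ (k + 1)) *
        (1 / ‖z - y‖ ^ 2 - 1 / ‖reflect n z - y‖ ^ 2))) ?_ ?_
  · rw [key, ENNReal.toReal_ofReal (mul_nonneg (by have := pi_pos; positivity) hlog),
      integral_const_mul] at hint
    rw [Real.log_div (by positivity) (by positivity), Real.log_pow, Real.log_pow] at hint
    rw [one_div ‖x - y‖, one_div ‖reflect n x - y‖, Real.log_inv, Real.log_inv]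
    field_simp
    field_simp at hint
    push_cast at hint
    linear_combination hint
  · refine (ae_restrict_iff' hH).2 ?_
    have : Nontrivial (E n) := ⟨x, y, hxy⟩
    filter_upwards [Measure.ae_ne volume x, Measure.ae_ne volume y] with z hzx hzy hz
    have h1 := norm_pos_iff.2 (sub_ne_zero.2 hzx.symm)
    have h2 := norm_pos_iff.2 (sub_ne_zero.2 hzy)
    have h3 := norm_sub_sq_le_norm_reflect_sub_sq hn0 hx hz
    have h4 := norm_sub_sq_le_norm_reflect_sub_sq hn0 hz hy
    exact mul_nonneg hf.le (mul_nonneg (sub_nonneg.2 (by gcongr)) (sub_nonneg.2 (by gcongr)))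
  · refine Measurable.aestronglyMeasurable ?_
    simp only [norm_reflect_sub hn0 _ y]
    fun_prop
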